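/- arXiv:1104.3908 — 2 statements merged into one kernel-verified Lean document; each statement's English description precedes it below -/
import Mathlib

section
/- Let E : 𝒮_n → 𝒮_m be a continuous linear operator which is the associated operator of an 𝒮-basis e of the whole space 𝒮'_n, i.e. the map ᵗE : 𝒮'_m → 𝒮'_n, a ↦ a ∘ E, is bijective, and let f : ℝ^m → ℂ be a slowly increasing smooth function with multiplication operator M_f on 𝒮_m. Then the product family fe is an 𝒮-basis of 𝒮'_n (i.e. the map a ↦ a ∘ (M_f ∘ E) is bijective from 𝒮'_m onto 𝒮'_n) if and only if f is an invertible element of the ring of slowly increasing smooth functions, i.e. f(x) ≠ 0 for every x ∈ ℝ^m and the pointwise reciprocal 1/f is also slowly increasing. -/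
open SchwartzMap

/-- The partial derivative of `f : ℝ^m → ℂ` in the `i`-th coordinate direction. -/
noncomputable def pDeriv {m : ℕ} (i : Fin m) (f : (Fin m → ℝ) → ℂ) : (Fin m → ℝ) → ℂ :=
  fun x => fderiv ℝ f x (Pi.single i 1)

/-- The multi-index partial derivative `∂^α f` of `f : ℝ^m → ℂ`. -/
noncomputable def multiDeriv {m : ℕ} (α : Fin m → ℕ) (f : (Fin m → ℝ) → ℂ) :
    (Fin m → ℝ) → ℂ :=
  (List.finRange m).foldr (fun i g => (pDeriv i)^[α i] g) f

/-- A function `f : ℝ^m → ℂ` is slowly increasing (of class `𝒪_M`) if it is smooth and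
every multi-index derivative `∂^α f` is bounded in absolute value by a polynomial. -/
def SlowlyIncreasing {m : ℕ} (f : (Fin m → ℝ) → ℂ) : Prop :=
  ContDiff ℝ (⊤ : ℕ∞) f ∧ ∀ α : Fin m → ℕ, ∃ P : MvPolynomial (Fin m) ℝ,
    ∀ x : Fin m → ℝ, ‖multiDeriv α f x‖ ≤ |MvPolynomial.eval x P|

open scoped ContDiff Topology

section SlowlyIncreasing

variable {m : ℕ}

theorem contDiff_pDeriv (i : Fin m) {f : (Fin m → ℝ) → ℂ} (hf : ContDiff ℝ ∞ f) :
    ContDiff ℝ ∞ (pDeriv i f) :=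
  (hf.fderiv_right (m := ∞) (by simp)).clm_apply contDiff_const

theorem contDiff_iterate_pDeriv (i : Fin m) (k : ℕ) {f : (Fin m → ℝ) → ℂ}
    (hf : ContDiff ℝ ∞ f) : ContDiff ℝ ∞ ((pDeriv i)^[k] f) := by
  induction k with
  | zero => exact hf
  | succ k ih =>
    rw [Function.iterate_succ_apply']
    exact contDiff_pDeriv i ih

theorem pDeriv_comm (i j : Fin m) {f : (Fin m → ℝ) → ℂ} (hf : ContDiff ℝ ∞ f) :
    pDeriv i (pDeriv j f) = pDeriv j (pDeriv i f) := by
  have hd : Differentiable ℝ (fderiv ℝ f) :=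
    (hf.fderiv_right (m := ∞) (by simp)).differentiable (by simp)
  have key : ∀ i j x, pDeriv i (pDeriv j f) x =
      fderiv ℝ (fderiv ℝ f) x (Pi.single i 1) (Pi.single j 1) := by
    intro i j x
    change fderiv ℝ (fun y => fderiv ℝ f y (Pi.single j 1)) x (Pi.single i 1) = _
    rw [fderiv_clm_apply (hd x) (by fun_prop)]
    simp
  funext x
  rw [key, key]
  have hf2 : ContDiff ℝ 2 f := contDiff_infty.1 hf 2
  exact (hf2.contDiffAt.isSymmSndFDerivAt (by simp)).eq _ _

theorem pDeriv_iterate_comm (i j : Fin m) (k : ℕ) {f : (Fin m → ℝ) → ℂ} (hf : ContDiff ℝ ∞ f) :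
    pDeriv i ((pDeriv j)^[k] f) = (pDeriv j)^[k] (pDeriv i f) := by
  induction k with
  | zero => rfl
  | succ k ih =>
    rw [Function.iterate_succ_apply', Function.iterate_succ_apply',
      pDeriv_comm _ _ (contDiff_iterate_pDeriv j k hf), ih]

theorem contDiff_foldr_pDeriv (α : Fin m → ℕ) (l : List (Fin m)) {f : (Fin m → ℝ) → ℂ}
    (hf : ContDiff ℝ ∞ f) :
    ContDiff ℝ ∞ (l.foldr (fun i g => (pDeriv i)^[α i] g) f) := by
  induction l with
  | nil => exact hf
  | cons j l ih => exact contDiff_iterate_pDeriv j _ ih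

theorem foldr_pDeriv_comm (α : Fin m → ℕ) (l : List (Fin m)) (i : Fin m)
    {f : (Fin m → ℝ) → ℂ} (hf : ContDiff ℝ ∞ f) :
    l.foldr (fun i g => (pDeriv i)^[α i] g) (pDeriv i f) =
      pDeriv i (l.foldr (fun i g => (pDeriv i)^[α i] g) f) := by
  induction l with
  | nil => rfl
  | cons j l ih =>
    rw [List.foldr_cons, List.foldr_cons, ih,
      pDeriv_iterate_comm _ _ _ (contDiff_foldr_pDeriv α l hf)]

theorem foldr_pDeriv_update (α : Fin m → ℕ) {l : List (Fin m)} (hl : l.Nodup) {i : Fin m}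
    (hi : i ∈ l) {f : (Fin m → ℝ) → ℂ} (hf : ContDiff ℝ ∞ f) :
    l.foldr (fun j g => (pDeriv j)^[Function.update α i (α i + 1) j] g) f =
      pDeriv i (l.foldr (fun j g => (pDeriv j)^[α j] g) f) := by
  induction l with
  | nil => simp at hi
  | cons j l ih =>
    obtain ⟨hj, hl⟩ := List.nodup_cons.1 hl
    rw [List.foldr_cons, List.foldr_cons]
    by_cases hij : j = i
    · subst hij
      rw [Function.update_self, Function.iterate_succ_apply']
      congr 2
      refine List.foldr_ext _ _ _ fun k hk g => ?_
      rw [Function.update_of_ne (by rintro rfl; exact hj hk)]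
    · rw [Function.update_of_ne hij, ih hl ((List.mem_cons.1 hi).resolve_left (Ne.symm hij)),
        pDeriv_iterate_comm _ _ _ (contDiff_foldr_pDeriv α l hf)]

theorem multiDeriv_pDeriv (α : Fin m → ℕ) (i : Fin m) {f : (Fin m → ℝ) → ℂ}
    (hf : ContDiff ℝ ∞ f) :
    multiDeriv α (pDeriv i f) = multiDeriv (Function.update α i (α i + 1)) f := by
  rw [multiDeriv, multiDeriv, foldr_pDeriv_comm α _ i hf,
    foldr_pDeriv_update α (List.nodup_finRange m) (List.mem_finRange i) hf]

theorem multiDeriv_zero (f : (Fin m → ℝ) → ℂ) : multiDeriv 0 f = f := by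
  unfold multiDeriv
  induction List.finRange m with
  | nil => rfl
  | cons j l ih => rw [List.foldr_cons, ih]; rfl

theorem SlowlyIncreasing.partialDeriv {f : (Fin m → ℝ) → ℂ} (hf : SlowlyIncreasing f) (i : Fin m) :
    SlowlyIncreasing (pDeriv i f) :=
  ⟨contDiff_pDeriv i hf.1, fun α => by rw [multiDeriv_pDeriv α i hf.1]; exact hf.2 _⟩

theorem hasTemperateGrowth_eval (P : MvPolynomial (Fin m) ℝ) :
    (fun x : Fin m → ℝ => MvPolynomial.eval x P).HasTemperateGrowth := by
  induction P using MvPolynomial.induction_on with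
  | C a => simp
  | add p q hp hq => simpa using hp.fun_add hq
  | mul_X p i hp =>
    simpa using hp.fun_mul (ContinuousLinearMap.proj (R := ℝ) i).hasTemperateGrowth

theorem fderiv_eq_sum_pDeriv (f : (Fin m → ℝ) → ℂ) :
    fderiv ℝ f = fun x => ∑ i, ContinuousLinearMap.smulRightL ℝ (Fin m → ℝ) ℂ
      (ContinuousLinearMap.proj i) (pDeriv i f x) := by
  ext x v
  conv_lhs => rw [pi_eq_sum_univ' v]
  simp [pDeriv, map_sum]

theorem SlowlyIncreasing.hasTemperateGrowth {f : (Fin m → ℝ) → ℂ} (hf : SlowlyIncreasing f) :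
    f.HasTemperateGrowth := by
  refine ⟨hf.1, fun n => ?_⟩
  induction n generalizing f with
  | zero =>
    obtain ⟨P, hP⟩ := hf.2 0
    obtain ⟨k, C, h⟩ := (hasTemperateGrowth_eval P).2 0
    refine ⟨k, C, fun x => ?_⟩
    rw [multiDeriv_zero] at hP
    simpa using (hP x).trans (by simpa using h x)
  | succ n ih =>
    choose k C h using fun i => ih (hf.partialDeriv i)
    set L := fun i : Fin m => ContinuousLinearMap.smulRightL ℝ (Fin m → ℝ) ℂ
      (ContinuousLinearMap.proj i)
    have hC : ∀ i, 0 ≤ C i := fun i => by simpa using (norm_nonneg _).trans (h i 0)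
    refine ⟨∑ i, k i, ∑ i, ‖L i‖ * C i, fun x => ?_⟩
    have hs : ∀ i, ContDiff ℝ n (pDeriv i f) := fun i =>
      (contDiff_pDeriv i hf.1).of_le (mod_cast le_top)
    rw [← norm_iteratedFDeriv_fderiv, fderiv_eq_sum_pDeriv,
      iteratedFDeriv_fun_sum_apply (f := fun i y => L i (pDeriv i f y))
        fun i _ => ((L i).contDiff.comp (hs i)).contDiffAt,
      Finset.sum_mul]
    refine (norm_sum_le _ _).trans (Finset.sum_le_sum fun i _ => ?_)
    refine ((L i).norm_iteratedFDeriv_comp_left (hs i).contDiffAt le_rfl).trans ?_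
    rw [mul_assoc]
    gcongr
    refine (h i x).trans ?_
    gcongr
    · exact hC i
    · simp
    · exact Finset.single_le_sum (f := k) (fun _ _ => Nat.zero_le _) (Finset.mem_univ i)

theorem hasTemperateGrowth_fderiv {E F : Type*} [NormedAddCommGroup E] [NormedSpace ℝ E]
    [NormedAddCommGroup F] [NormedSpace ℝ F] {f : E → F} (hf : f.HasTemperateGrowth) :
    (fderiv ℝ f).HasTemperateGrowth := by
  refine ⟨hf.1.fderiv_right (by simp), fun n => ?_⟩
  simpa only [norm_iteratedFDeriv_fderiv] using hf.2 (n + 1)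

theorem hasTemperateGrowth_pDeriv (i : Fin m) {f : (Fin m → ℝ) → ℂ} (hf : f.HasTemperateGrowth) :
    (pDeriv i f).HasTemperateGrowth :=
  ((ContinuousLinearMap.apply ℝ ℂ (Pi.single i 1 : Fin m → ℝ)).hasTemperateGrowth).comp
    (hasTemperateGrowth_fderiv hf)

theorem hasTemperateGrowth_multiDeriv (α : Fin m → ℕ) {f : (Fin m → ℝ) → ℂ}
    (hf : f.HasTemperateGrowth) : (multiDeriv α f).HasTemperateGrowth := by
  unfold multiDeriv
  induction List.finRange m with
  | nil => exact hf
  | cons j l ih =>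
    rw [List.foldr_cons]
    induction α j with
    | zero => exact ih
    | succ k ihk =>
      rw [Function.iterate_succ_apply']
      exact hasTemperateGrowth_pDeriv j ihk

theorem one_add_norm_le_two_add_sum_sq (x : Fin m → ℝ) : 1 + ‖x‖ ≤ 2 + ∑ i, x i ^ 2 := by
  have h : ‖x‖ ≤ 1 + ∑ i, x i ^ 2 := by
    refine (pi_norm_le_iff_of_nonneg (by positivity)).2 fun i => ?_
    have := Finset.single_le_sum (f := fun i => x i ^ 2) (fun _ _ => sq_nonneg _)
      (Finset.mem_univ i)
    rw [Real.norm_eq_abs]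
    nlinarith [sq_nonneg (|x i| - 1), sq_abs (x i)]
  linarith

theorem slowlyIncreasing_iff_hasTemperateGrowth {f : (Fin m → ℝ) → ℂ} :
    SlowlyIncreasing f ↔ f.HasTemperateGrowth := by
  refine ⟨SlowlyIncreasing.hasTemperateGrowth, fun hf => ⟨hf.1, fun α => ?_⟩⟩
  obtain ⟨k, C, h⟩ := (hasTemperateGrowth_multiDeriv α hf).2 0
  have hC : 0 ≤ C := by simpa using (norm_nonneg _).trans (h 0)
  refine ⟨MvPolynomial.C C * (2 + ∑ i, MvPolynomial.X i ^ 2) ^ k, fun x => ?_⟩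
  have hx := h x
  rw [norm_iteratedFDeriv_zero] at hx
  refine hx.trans (le_trans ?_ (le_abs_self _))
  simp only [map_mul, map_pow, map_add, map_sum, map_ofNat, MvPolynomial.eval_C,
    MvPolynomial.eval_X]
  gcongr ?_ * ?_ ^ _
  exact one_add_norm_le_two_add_sum_sq x

end SlowlyIncreasing

theorem hasTemperateGrowth_inv_of_one_le {D : Type*} [NormedAddCommGroup D] [NormedSpace ℝ D]
    {f : D → ℝ} (hf : f.HasTemperateGrowth) (h1 : ∀ x, 1 ≤ f x) :
    (fun x => (f x)⁻¹).HasTemperateGrowth := by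
  set t := Set.Ioi (1 / 2 : ℝ)
  have hpos : ∀ y ∈ t, 0 < y := fun y hy => lt_trans (by norm_num) hy
  have ht : UniqueDiffOn ℝ t := isOpen_Ioi.uniqueDiffOn
  refine Function.HasTemperateGrowth.comp' (g := fun y : ℝ => y⁻¹) (t := t) ?_ ht
    (contDiffOn_id.inv fun y hy => (hpos y hy).ne') (fun N => ?_) hf
  · rintro - ⟨x, rfl⟩
    exact lt_of_lt_of_le (by norm_num) (h1 x)
  · refine ⟨0, N.factorial * 2 ^ (N + 1), by positivity, fun n hn y hy => ?_⟩
    have hy0 := hpos y hy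
    rw [norm_iteratedFDerivWithin_eq_norm_iteratedDerivWithin,
      iteratedDerivWithin_eq_iteratedDeriv ht (contDiffAt_inv ℝ hy0.ne') hy,
      iteratedDeriv_eq_iterate, iter_deriv_inv]
    have e : (-1 - n : ℤ) = -((n + 1 : ℕ) : ℤ) := by push_cast; ring
    have h2 : y⁻¹ ≤ 2 := by
      rw [inv_le_comm₀ hy0 two_pos]
      have : (1 / 2 : ℝ) < y := hy
      linarith
    rw [e, zpow_neg, zpow_natCast, ← inv_pow]
    simp only [norm_mul, norm_pow, norm_neg, norm_one, one_pow, one_mul, pow_zero, mul_one,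
      Real.norm_natCast, Real.norm_of_nonneg (inv_nonneg.2 hy0.le)]
    gcongr
    calc y⁻¹ ^ (n + 1) ≤ 2 ^ (n + 1) := by gcongr
      _ ≤ 2 ^ (N + 1) := by gcongr; norm_num

theorem hasTemperateGrowth_inv {m : ℕ} {f : (Fin m → ℝ) → ℂ} (hf : f.HasTemperateGrowth)
    (h0 : ∀ x, f x ≠ 0) {k : ℕ} {C : ℝ} (h : ∀ x, ‖(f x)⁻¹‖ ≤ C * (1 + ‖x‖) ^ k) :
    (fun x => (f x)⁻¹).HasTemperateGrowth := by
  have hC : 0 ≤ C := by simpa using (norm_nonneg _).trans (h 0)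
  set Q : (Fin m → ℝ) → ℝ := fun x => MvPolynomial.eval x
    (MvPolynomial.C C * (2 + ∑ i, MvPolynomial.X i ^ 2) ^ k) with hQdef
  have hQ : Q.HasTemperateGrowth := hasTemperateGrowth_eval _
  have hQf : ∀ x, 1 ≤ Q x * ‖f x‖ := fun x => by
    have : ‖(f x)⁻¹‖ ≤ Q x := by
      refine (h x).trans ?_
      simp only [hQdef, map_mul, map_pow, map_add, map_sum, map_ofNat, MvPolynomial.eval_C,
        MvPolynomial.eval_X]
      gcongr ?_ * ?_ ^ _
      exact one_add_norm_le_two_add_sum_sq x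
    rw [norm_inv] at this
    exact (inv_le_iff_one_le_mul₀ (norm_pos_iff.2 (h0 x))).1 this
  have hw : (fun x => ((Q x) ^ 2 * ‖f x‖ ^ 2)⁻¹).HasTemperateGrowth := by
    refine hasTemperateGrowth_inv_of_one_le
      ((hQ.fun_pow 2).fun_mul ((Function.hasTemperateGrowth_norm_sq ℂ).comp hf)) fun x => ?_
    rw [← mul_pow]
    exact one_le_pow₀ (hQf x)
  have hconj : (fun x => (starRingEnd ℂ) (f x)).HasTemperateGrowth :=
    (Complex.conjCLE.hasTemperateGrowth).comp hf
  have hprod := hconj.fun_mul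
    (Function.Complex.hasTemperateGrowth_ofReal.comp ((hQ.fun_pow 2).fun_mul hw))
  refine (congrArg Function.HasTemperateGrowth (funext fun x => ?_)).mpr hprod
  have hq : Q x ≠ 0 := fun hq => by
    have := hQf x
    rw [hq, zero_mul] at this
    linarith
  rw [Function.comp_apply, mul_inv, mul_inv_cancel_left₀ (pow_ne_zero 2 hq), Complex.inv_def,
    Complex.normSq_eq_norm_sq]

theorem exists_separated_seq {E : Type*} [SeminormedAddCommGroup E] [ProperSpace E]
    {u : E → ℝ} (hu : Continuous u)
    (hub : ∀ (k : ℕ) (C : ℝ), ∃ x, C * (1 + ‖x‖) ^ k < u x) :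
    ∃ x : ℕ → E, (∀ j : ℕ, (j : ℝ) ≤ ‖x j‖) ∧ (∀ j, (1 + ‖x j‖) ^ j < u (x j)) ∧
      ∀ i j, i ≠ j → 1 ≤ ‖x i - x j‖ := by
  have hfar : ∀ (k : ℕ) (R : ℝ), ∃ x, R ≤ ‖x‖ ∧ (1 + ‖x‖) ^ k < u x := by
    intro k R
    obtain ⟨B, hB⟩ := (isCompact_closedBall (0 : E) R).bddAbove_image hu.continuousOn
    obtain ⟨x, hx⟩ := hub k (max B 1)
    have hp : 1 ≤ (1 + ‖x‖) ^ k := one_le_pow₀ (by simp)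
    refine ⟨x, ?_, lt_of_le_of_lt ?_ hx⟩
    · by_contra! hlt
      have := hB (Set.mem_image_of_mem u (mem_closedBall_zero_iff.2 hlt.le))
      nlinarith [le_max_left B 1, le_max_right B 1]
    · nlinarith [le_max_right B 1]
  obtain ⟨v, hv, hvr⟩ := exists_seq_of_forall_finset_exists
    (fun p : ℕ × E => (p.1 : ℝ) ≤ ‖p.2‖ ∧ (1 + ‖p.2‖) ^ p.1 < u p.2)
    (fun p q => p.1 < q.1 ∧ ‖p.2‖ + 1 ≤ ‖q.2‖) (by
      intro s _
      obtain ⟨x, hx, hxu⟩ := hfar (s.sup Prod.fst + 1)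
        (max ((s.sup Prod.fst + 1 : ℕ) : ℝ) (∑ p ∈ s, (‖p.2‖ + 1)))
      refine ⟨(_, x), ⟨(le_max_left _ _).trans hx, hxu⟩, fun p hp => ⟨?_, ?_⟩⟩
      · exact Nat.lt_succ_of_le (Finset.le_sup (f := Prod.fst) hp)
      · exact (Finset.single_le_sum (f := fun p : ℕ × E => ‖p.2‖ + 1)
          (fun _ _ => by positivity) hp).trans ((le_max_right _ _).trans hx))
  have hid : ∀ j, j ≤ (v j).1 := fun _ => (strictMono_nat_of_lt_succ (f := fun j => (v j).1)
    fun j => (hvr j (j + 1) j.lt_succ_self).1).le_apply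
  have hsep : ∀ i j, i < j → 1 ≤ ‖(v j).2 - (v i).2‖ := fun i j hij => by
    linarith [(hvr i j hij).2, norm_sub_norm_le (v j).2 (v i).2]
  refine ⟨fun j => (v j).2, fun j => le_trans (mod_cast hid j) (hv j).1,
    fun j => lt_of_le_of_lt (pow_le_pow_right₀ (by simp) (hid j)) (hv j).2, fun i j hij => ?_⟩
  rcases hij.lt_or_gt with h | h
  · rw [norm_sub_rev]
    exact hsep i j h
  · exact hsep j i h

section Schwartz

variable {E : Type*} [NormedAddCommGroup E] [NormedSpace ℝ E]

theorem exists_clm_eq_tsum_eval {x : ℕ → E} (hx : ∀ j : ℕ, (j : ℝ) ≤ ‖x j‖) :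
    ∃ b : 𝓢(E, ℂ) →L[ℂ] ℂ, ∀ g : 𝓢(E, ℂ), b g = ∑' j, g (x j) := by
  set S : 𝓢(E, ℂ) → ℝ := fun g =>
    (Finset.Iic ((2, 0) : ℕ × ℕ)).sup (schwartzSeminormFamily ℂ E ℂ) g
  have hsum : Summable fun j : ℕ => 1 / ((j + 1 : ℕ) : ℝ) ^ 2 :=
    (summable_nat_add_iff 1).2 (Real.summable_one_div_nat_pow.2 one_lt_two)
  have hbound : ∀ (g : 𝓢(E, ℂ)) (j : ℕ), ‖g (x j)‖ ≤ 4 * S g * (1 / ((j + 1 : ℕ) : ℝ) ^ 2) := by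
    intro g j
    have h := one_add_le_sup_seminorm_apply (𝕜 := ℂ) (m := (2, 0)) le_rfl le_rfl g (x j)
    rw [norm_iteratedFDeriv_zero] at h
    rw [mul_one_div, le_div_iff₀ (by positivity), mul_comm]
    refine le_trans ?_ (h.trans_eq ?_)
    · gcongr
      push_cast
      linarith [hx j]
    · norm_num [S]
      rfl
  have hs : ∀ g : 𝓢(E, ℂ), Summable fun j => g (x j) := fun g =>
    Summable.of_norm_bounded (hsum.mul_left _) (hbound g)
  refine ⟨mkCLMtoNormedSpace (σ := RingHom.id ℂ) (fun g => ∑' j, g (x j)) (fun g h => ?_)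
    (fun c g => ?_) ⟨Finset.Iic (2, 0), 4 * ∑' j : ℕ, 1 / ((j + 1 : ℕ) : ℝ) ^ 2,
      by positivity, fun g => ?_⟩, fun g => rfl⟩
  · simpa using (hs g).tsum_add (hs h)
  · simpa using (tsum_mul_left (a := c) (f := fun j => g (x j)))
  · refine (tsum_of_norm_bounded (hsum.mul_left _).hasSum (hbound g)).trans_eq ?_
    rw [tsum_mul_left]
    ring

theorem exists_schwartz_bump [FiniteDimensional ℝ E] :
    ∃ φ : 𝓢(E, ℂ), φ 0 = 1 ∧ ∀ y, 1 / 2 ≤ ‖y‖ → φ y = 0 := by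
  obtain ⟨β, hβ⟩ : ∃ β : ContDiffBump (0 : E), β.rOut = 1 / 2 :=
    ⟨⟨1 / 4, 1 / 2, by norm_num, by norm_num⟩, rfl⟩
  have hc : HasCompactSupport fun y => (β y : ℂ) :=
    β.hasCompactSupport.comp_left (g := ((↑) : ℝ → ℂ)) Complex.ofReal_zero
  have hsm : ContDiff ℝ ∞ fun y => (β y : ℂ) := Complex.ofRealCLM.contDiff.comp β.contDiff
  refine ⟨hc.toSchwartzMap hsm, ?_, fun y hy => ?_⟩
  · change ((β 0 : ℝ) : ℂ) = 1
    rw [β.one_of_mem_closedBall (Metric.mem_closedBall_self β.rIn_pos.le), Complex.ofReal_one]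
  · change ((β y : ℝ) : ℂ) = 0
    rw [β.zero_of_le_dist (by rwa [hβ, dist_zero_right]), Complex.ofReal_zero]

theorem seminorm_smul_translate_le (φ : 𝓢(E, ℂ)) (k n : ℕ) : ∃ A : ℝ, 0 ≤ A ∧
    ∀ (c : ℂ) (y : E) (h : 𝓢(E, ℂ)), (∀ x, h x = c * φ (x - y)) →
      SchwartzMap.seminorm ℂ k n h ≤ A * ‖c‖ * (1 + ‖y‖) ^ k := by
  refine ⟨2 ^ k * (Finset.Iic ((k, n) : ℕ × ℕ)).sup (schwartzSeminormFamily ℂ E ℂ) φ,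
    by positivity, fun c y h hh => seminorm_le_bound ℂ k n h (by positivity) fun x => ?_⟩
  have hfun : (h : E → ℂ) = c • fun x => φ (x - y) := funext hh
  have hsm : ContDiff ℝ n fun x => φ (x - y) :=
    (φ.smooth n).comp (contDiff_id.sub contDiff_const)
  rw [hfun, iteratedFDeriv_const_smul_apply hsm.contDiffAt, norm_smul, iteratedFDeriv_comp_sub]
  have h1 : ‖x‖ ≤ (1 + ‖y‖) * (1 + ‖x - y‖) := by
    nlinarith [norm_sub_norm_le x y, norm_nonneg y, norm_nonneg (x - y)]
  calc ‖x‖ ^ k * (‖c‖ * ‖iteratedFDeriv ℝ n φ (x - y)‖)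
      ≤ ((1 + ‖y‖) * (1 + ‖x - y‖)) ^ k * (‖c‖ * ‖iteratedFDeriv ℝ n φ (x - y)‖) := by gcongr
    _ = ((1 + ‖x - y‖) ^ k * ‖iteratedFDeriv ℝ n φ (x - y)‖) * ‖c‖ * (1 + ‖y‖) ^ k := by
        rw [mul_pow]
        ring
    _ ≤ _ := by
      refine mul_le_mul_of_nonneg_right (mul_le_mul_of_nonneg_right ?_ (norm_nonneg c))
        (by positivity)
      exact one_add_le_sup_seminorm_apply (𝕜 := ℂ) (m := (k, n)) le_rfl le_rfl φ (x - y)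

theorem exists_norm_inv_le_of_surjective [FiniteDimensional ℝ E] {f : E → ℂ}
    (hf : ContDiff ℝ ∞ f) (h0 : ∀ x, f x ≠ 0) (M : 𝓢(E, ℂ) →L[ℂ] 𝓢(E, ℂ))
    (hM : ∀ (g : 𝓢(E, ℂ)) (x : E), M g x = f x * g x)
    (hsurj : Function.Surjective fun a : 𝓢(E, ℂ) →L[ℂ] ℂ => a.comp M) :
    ∃ (k : ℕ) (C : ℝ), ∀ x, ‖(f x)⁻¹‖ ≤ C * (1 + ‖x‖) ^ k := by
  by_contra! hcon
  have : ProperSpace E := FiniteDimensional.proper ℝ E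
  obtain ⟨x, hx, hxf, hsep⟩ := exists_separated_seq (u := fun x => ‖(f x)⁻¹‖)
    (hf.continuous.inv₀ h0).norm hcon
  obtain ⟨b, hb⟩ := exists_clm_eq_tsum_eval hx
  obtain ⟨a, rfl⟩ := hsurj b
  obtain ⟨φ, hφ0, hφ⟩ := exists_schwartz_bump (E := E)
  have hg : ∀ j, ∃ g : 𝓢(E, ℂ), ∀ y, g y = f (x j) * φ (y - x j) * (f y)⁻¹ := by
    intro j
    have hsupp : HasCompactSupport fun y => f (x j) * φ (y - x j) * (f y)⁻¹ := by
      refine HasCompactSupport.intro (isCompact_closedBall (x j) (1 / 2)) fun y hy => ?_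
      rw [Metric.mem_closedBall, dist_eq_norm, not_le] at hy
      rw [hφ _ hy.le, mul_zero, zero_mul]
    exact ⟨hsupp.toSchwartzMap ((contDiff_const.mul
      ((φ.smooth ⊤).comp (contDiff_id.sub contDiff_const))).mul (hf.inv h0)), fun y => rfl⟩
  choose g hg using hg
  have hMg : ∀ j y, M (g j) y = f (x j) * φ (y - x j) := fun j y => by
    rw [hM, hg]
    field_simp [h0 y]
  have hone : ∀ j, a (M (g j)) = 1 := fun j => by
    refine (hb (g j)).trans ((tsum_eq_single j fun i hij => ?_).trans ?_)
    · rw [hg, hφ _ (le_trans (by norm_num) (hsep i j hij)), mul_zero, zero_mul]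
    · rw [hg, sub_self, hφ0, mul_one, mul_inv_cancel₀ (h0 _)]
  have hlim : Filter.Tendsto (fun j => M (g j)) Filter.atTop (𝓝 0) := by
    refine ((schwartz_withSeminorms ℂ E ℂ).tendsto_nhds _ _).2 fun ⟨k, n⟩ ε hε => ?_
    obtain ⟨A, hA, hAb⟩ := seminorm_smul_translate_le φ k n
    have hA0 : Filter.Tendsto (fun j : ℕ => A * (1 / ((j : ℝ) + 1))) Filter.atTop (𝓝 0) := by
      simpa using tendsto_one_div_add_atTop_nhds_zero_nat.const_mul A
    filter_upwards [hA0.eventually (gt_mem_nhds hε), Filter.eventually_ge_atTop (k + 1)]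
      with j hj hkj
    rw [sub_zero]
    refine ((hAb _ _ _ (hMg j)).trans ?_).trans_lt hj
    have hpos : 0 < ‖f (x j)‖ := norm_pos_iff.2 (h0 _)
    have h1 : ‖f (x j)‖ * (1 + ‖x j‖) ^ j ≤ 1 := by
      have := (hxf j).le
      rw [norm_inv] at this
      calc _ ≤ ‖f (x j)‖ * ‖f (x j)‖⁻¹ := by gcongr
        _ = 1 := mul_inv_cancel₀ hpos.ne'
    rw [mul_assoc]
    gcongr
    rw [le_div_iff₀ (by positivity)]
    refine le_trans ?_ h1
    rw [mul_assoc]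
    gcongr
    calc (1 + ‖x j‖) ^ k * ((j : ℝ) + 1) ≤ (1 + ‖x j‖) ^ k * (1 + ‖x j‖) :=
          mul_le_mul_of_nonneg_left (by linarith [hx j]) (by positivity)
      _ = (1 + ‖x j‖) ^ (k + 1) := (pow_succ _ _).symm
      _ ≤ (1 + ‖x j‖) ^ j := pow_le_pow_right₀ (by simp) hkj
  have ha := (a.continuous.tendsto 0).comp hlim
  simp only [Function.comp_def, hone, map_zero] at ha
  exact one_ne_zero (tendsto_nhds_unique tendsto_const_nhds ha)

theorem ne_zero_of_injective (f : E → ℂ) (M : 𝓢(E, ℂ) →L[ℂ] 𝓢(E, ℂ)) [FiniteDimensional ℝ E]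
    (hM : ∀ (g : 𝓢(E, ℂ)) (x : E), M g x = f x * g x)
    (hinj : Function.Injective fun a : 𝓢(E, ℂ) →L[ℂ] ℂ => a.comp M) (x : E) : f x ≠ 0 := by
  intro hx
  have hδ : (BoundedContinuousFunction.evalCLM ℂ x).comp
      (toBoundedContinuousFunctionCLM ℂ E ℂ) = 0 := hinj <| by
    ext g
    simp [hM, hx]
  obtain ⟨φ, hφ, -⟩ := exists_schwartz_bump (E := E)
  have h := DFunLike.congr_fun hδ (compSubConstCLM ℂ x φ)
  simp [hφ] at h

end Schwartz
/-- Let `e` be an 𝒮-basis of the whole space `𝒮'_n` (i.e. the transpose of its associated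
operator `E` is bijective) and let `f` be slowly increasing with multiplication operator
`M_f`. Then the product family `fe` (associated operator `M_f ∘ E`) is an 𝒮-basis of `𝒮'_n`
if and only if `f` is invertible in the ring of slowly increasing functions, i.e. `f` is
nowhere vanishing and its pointwise reciprocal is slowly increasing. -/
theorem mul_basis_iff_invertible {n m : ℕ}
    (E : 𝓢((Fin n → ℝ), ℂ) →L[ℂ] 𝓢((Fin m → ℝ), ℂ))
    (hE : Function.Bijective
      (fun a : 𝓢((Fin m → ℝ), ℂ) →L[ℂ] ℂ => a.comp E))
    (f : (Fin m → ℝ) → ℂ) (hf : SlowlyIncreasing f)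
    (M : 𝓢((Fin m → ℝ), ℂ) →L[ℂ] 𝓢((Fin m → ℝ), ℂ))
    (hM : ∀ (g : 𝓢((Fin m → ℝ), ℂ)) (x : Fin m → ℝ), M g x = f x * g x) :
    Function.Bijective
        (fun a : 𝓢((Fin m → ℝ), ℂ) →L[ℂ] ℂ => a.comp (M.comp E)) ↔
      ((∀ x, f x ≠ 0) ∧ SlowlyIncreasing (fun x => (f x)⁻¹)) := by
  have hcomp : (fun a : 𝓢((Fin m → ℝ), ℂ) →L[ℂ] ℂ => a.comp (M.comp E)) =
      (fun a : 𝓢((Fin m → ℝ), ℂ) →L[ℂ] ℂ => a.comp E) ∘ fun a => a.comp M := rfl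
  rw [hcomp, hE.of_comp_iff']
  constructor
  · intro h
    have h0 := ne_zero_of_injective f M hM h.1
    obtain ⟨k, C, hb⟩ := exists_norm_inv_le_of_surjective hf.1 h0 M hM h.2
    exact ⟨h0, slowlyIncreasing_iff_hasTemperateGrowth.2
      (hasTemperateGrowth_inv hf.hasTemperateGrowth h0 hb)⟩
  · rintro ⟨h0, hinv⟩
    set N := smulLeftCLM ℂ fun x => (f x)⁻¹
    have hN : ∀ (g : 𝓢((Fin m → ℝ), ℂ)) x, N g x = (f x)⁻¹ * g x :=
      smulLeftCLM_apply_apply hinv.hasTemperateGrowth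
    have hMN : M.comp N = .id ℂ _ := by
      ext g x
      simp [hM, hN, h0 x]
    have hNM : N.comp M = .id ℂ _ := by
      ext g x
      simp [hM, hN, h0 x]
    refine Function.bijective_iff_has_inverse.2 ⟨fun a => a.comp N, fun a => ?_, fun a => ?_⟩
    · simp only [ContinuousLinearMap.comp_assoc, hMN, ContinuousLinearMap.comp_id]
    · simp only [ContinuousLinearMap.comp_assoc, hNM, ContinuousLinearMap.comp_id]
end

section
/- Let E : 𝒮_n → 𝒮_m be a continuous linear operator which is the associated operator of an 𝒮-basis e of the whole space 𝒮'_n (i.e. a ↦ a ∘ E is a bijection from 𝒮'_m onto 𝒮'_n), let f : ℝ^m → ℂ be a slowly increasing smooth function, and suppose the product family fe is also an 𝒮-basis of 𝒮'_n (i.e. a ↦ a ∘ (M_f ∘ E) is a bijection from 𝒮'_m onto 𝒮'_n). Then f(x) ≠ 0 for every x ∈ ℝ^m, and for every Schwartz function g ∈ 𝒮_m the function x ↦ g(x)/f(x) is again a Schwartz function; in fact for every g ∈ 𝒮_m there exists h ∈ 𝒮_n with f·E(h) = g, so that g/f = E(h) ∈ 𝒮_m. -/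
open SchwartzMap

/-- **Mackey's theorem** for a single seminorm: a family on which every `p`-bounded linear
functional is bounded is itself `p`-bounded. -/
theorem Seminorm.exists_forall_le_of_forall_functional_bounded {X ι : Type*} [AddCommGroup X]
    [Module ℂ X] (p : Seminorm ℂ X) (s : ι → X)
    (h : ∀ a : X →ₗ[ℂ] ℂ, (∃ C, ∀ x, ‖a x‖ ≤ C * p x) → ∃ C, ∀ i, ‖a (s i)‖ ≤ C) :
    ∃ C, ∀ i, p (s i) ≤ C := by
  let : SeminormedAddCommGroup X :=
    AddGroupSeminorm.toSeminormedAddCommGroup p.toAddGroupSeminorm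
  let : NormedSpace ℂ X := ⟨fun c x => (map_smul_eq_mul p c x).le⟩
  obtain ⟨C, hC⟩ := banach_steinhaus
    (g := fun i => NormedSpace.inclusionInDoubleDual ℂ X (s i)) fun a =>
      h a.toLinearMap ⟨‖a‖, fun x => a.le_opNorm x⟩
  refine ⟨C, fun i => ?_⟩
  obtain ⟨a, ha, has⟩ := exists_dual_vector'' ℂ (s i)
  calc p (s i) = ‖s i‖ := rfl
    _ = ‖NormedSpace.inclusionInDoubleDual ℂ X (s i) a‖ := by simp [has]
    _ ≤ ‖NormedSpace.inclusionInDoubleDual ℂ X (s i)‖ * ‖a‖ := ContinuousLinearMap.le_opNorm _ _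
    _ ≤ ‖NormedSpace.inclusionInDoubleDual ℂ X (s i)‖ * 1 := by gcongr
    _ ≤ C := by simpa using hC i

open Filter Topology in
/-- A continuous linear map from a locally convex space to a first countable space whose transpose
is surjective induces the topology of its domain. -/
theorem ContinuousLinearMap.isInducing_of_surjective_transpose {X Y ι : Type*}
    [AddCommGroup X] [Module ℂ X] [TopologicalSpace X] [IsTopologicalAddGroup X]
    [AddCommGroup Y] [Module ℂ Y] [TopologicalSpace Y] [IsTopologicalAddGroup Y]
    [ContinuousSMul ℂ Y] [FirstCountableTopology Y]
    {p : SeminormFamily ℂ X ι} (hp : WithSeminorms p) (T : X →L[ℂ] Y)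
    (hT : Function.Surjective fun a : Y →L[ℂ] ℂ => a.comp T) : IsInducing T := by
  refine IsTopologicalAddGroup.isInducing_iff_nhds_zero.2 (le_antisymm ?_ ?_)
  · exact map_le_iff_le_comap.1 (T.continuous.tendsto' 0 0 (map_zero T))
  have key : ∀ (i : ι) (ε : ℝ), 0 < ε → ∃ V ∈ 𝓝 (0 : Y), ∀ x, T x ∈ V → p i x < ε := by
    intro i ε hε
    by_contra! hcon
    obtain ⟨V, hV⟩ := (𝓝 (0 : Y)).exists_antitone_basis
    have hW : ∀ k : ℕ, {y : Y | ((k : ℂ) + 1) • y ∈ V k} ∈ 𝓝 (0 : Y) := fun k =>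
      (continuous_const_smul ((k : ℂ) + 1)).tendsto' 0 0 (by simp) (hV.1.mem_of_mem trivial)
    choose x hxV hxp using fun k => hcon _ (hW k)
    obtain ⟨C, hC⟩ := (p i).exists_forall_le_of_forall_functional_bounded
      (fun k : ℕ => ((k : ℂ) + 1) • x k) (by
        rintro a ⟨C, hC⟩
        have ha : Continuous a :=
          hp.continuous_normedSpace_rng ℂ a ⟨{i}, C.toNNReal, fun x => by
            simpa [NNReal.smul_def] using (hC x).trans
              (mul_le_mul_of_nonneg_right (Real.le_coe_toNNReal C) (apply_nonneg (p i) x))⟩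
        obtain ⟨b, hb⟩ := hT ⟨a, ha⟩
        have hlim : Tendsto (fun k : ℕ => ((k : ℂ) + 1) • T (x k)) atTop (𝓝 0) :=
          hV.tendsto hxV
        have hlim' : Tendsto (fun k : ℕ => a (((k : ℂ) + 1) • x k)) atTop (𝓝 0) := by
          have hba : ∀ x, a x = b (T x) := fun x => (DFunLike.congr_fun hb x).symm
          simp only [hba, map_smul T]
          exact (b.continuous.tendsto' 0 0 (map_zero b)).comp hlim
        obtain ⟨D, hD⟩ := hlim'.norm.bddAbove_range
        exact ⟨D, fun k => hD ⟨k, rfl⟩⟩)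
    obtain ⟨k, hk⟩ := exists_nat_gt (C / ε)
    have h1 := hC k
    have h2 : ‖(k : ℂ) + 1‖ = k + 1 := by exact_mod_cast Complex.norm_natCast (k + 1)
    rw [map_smul_eq_mul, h2] at h1
    rw [div_lt_iff₀ hε] at hk
    nlinarith [hxp k, (Nat.cast_nonneg k : (0 : ℝ) ≤ k)]
  refine (hp.tendsto_nhds (u := id) (f := comap T (𝓝 0)) 0).2 fun i ε hε => ?_
  obtain ⟨V, hV, hVp⟩ := key i ε hε
  exact mem_comap.2 ⟨V, by simpa using hV, fun x hx => by simpa using hVp x hx⟩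

/-- A continuous linear map into a locally convex space whose transpose is injective has dense
range. -/
theorem ContinuousLinearMap.denseRange_of_injective_transpose {X Y : Type*}
    [AddCommGroup X] [Module ℂ X] [TopologicalSpace X]
    [AddCommGroup Y] [Module ℂ Y] [TopologicalSpace Y] [IsTopologicalAddGroup Y]
    [ContinuousSMul ℂ Y] [Module ℝ Y] [IsScalarTower ℝ ℂ Y] [LocallyConvexSpace ℝ Y]
    (T : X →L[ℂ] Y) (hT : Function.Injective fun a : Y →L[ℂ] ℂ => a.comp T) : DenseRange T := by
  intro y
  by_contra hy
  have := IsScalarTower.continuousSMul (M := ℝ) (α := Y) ℂ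
  have hconv : Convex ℝ (Set.range T) := by
    rintro _ ⟨u, rfl⟩ _ ⟨v, rfl⟩ a b - - -
    refine ⟨(a : ℂ) • u + (b : ℂ) • v, ?_⟩
    simp [← algebraMap_smul ℂ a (T u), ← algebraMap_smul ℂ b (T v)]
  obtain ⟨a, r, har, hr⟩ := RCLike.geometric_hahn_banach_closed_point (𝕜 := ℂ)
    hconv.closure isClosed_closure hy
  have h0 : ∀ x, a (T x) = 0 := by
    intro x
    by_contra hx
    have h1 := har (T (((r : ℂ) / a (T x)) • x)) (subset_closure ⟨_, rfl⟩)
    simp [hx] at h1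
  have ha : a = 0 := hT (by ext x; simpa using h0 x)
  have h1 := har (T 0) (subset_closure ⟨_, rfl⟩)
  subst ha
  simp at h1 hr
  linarith

/-- A continuous linear map from a complete locally convex space to a metrizable locally convex
space is surjective as soon as its transpose is bijective. -/
theorem ContinuousLinearMap.surjective_of_bijective_transpose {X Y ι : Type*}
    [AddCommGroup X] [Module ℂ X] [UniformSpace X] [IsUniformAddGroup X] [CompleteSpace X]
    [AddCommGroup Y] [Module ℂ Y] [UniformSpace Y] [IsUniformAddGroup Y] [T2Space Y]
    [ContinuousSMul ℂ Y] [FirstCountableTopology Y]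
    [Module ℝ Y] [IsScalarTower ℝ ℂ Y] [LocallyConvexSpace ℝ Y]
    {p : SeminormFamily ℂ X ι} (hp : WithSeminorms p) (T : X →L[ℂ] Y)
    (hT : Function.Bijective fun a : Y →L[ℂ] ℂ => a.comp T) : Function.Surjective T := by
  have hind := T.isInducing_of_surjective_transpose hp hT.2
  have hclosed : IsClosed (Set.range T) :=
    (AddMonoidHom.isUniformInducing_of_isInducing hind).isComplete_range.isClosed
  exact Set.range_eq_univ.1 <| hclosed.closure_eq.symm.trans
    (T.denseRange_of_injective_transpose hT.1).closure_range

namespace SchwartzMap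

variable {V W : Type*} [NormedAddCommGroup V] [NormedSpace ℝ V]
  [NormedAddCommGroup W] [NormedSpace ℝ W] [CompleteSpace W]

/-- A series of Schwartz functions which is absolutely summable for every Schwartz seminorm
converges pointwise to a Schwartz function. -/
theorem exists_hasSum_of_summable_seminorm (d : ℕ → 𝓢(V, W))
    (hd : ∀ k n, Summable fun j => SchwartzMap.seminorm ℝ k n (d j)) :
    ∃ F : 𝓢(V, W), (∀ x, HasSum (fun j => d j x) (F x)) ∧
      ∀ k n, SchwartzMap.seminorm ℝ k n F ≤ ∑' j, SchwartzMap.seminorm ℝ k n (d j) := by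
  have hsm : ∀ j, ContDiff ℝ (⊤ : ℕ∞) (d j) := fun j => (d j).smooth ⊤
  have hbd : ∀ (k : ℕ) (j : ℕ) (x : V), (k : ℕ∞) ≤ ⊤ →
      ‖iteratedFDeriv ℝ k (d j) x‖ ≤ SchwartzMap.seminorm ℝ 0 k (d j) :=
    fun k j x _ => norm_iteratedFDeriv_le_seminorm ℝ (d j) k x
  have hdecay : ∀ (k n : ℕ) (x : V), ‖x‖ ^ k * ‖iteratedFDeriv ℝ n (fun y => ∑' j, d j y) x‖ ≤
      ∑' j, SchwartzMap.seminorm ℝ k n (d j) := by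
    intro k n x
    rw [iteratedFDeriv_tsum_apply hsm (fun k _ => hd 0 k) hbd le_top]
    have hs : Summable fun j => ‖iteratedFDeriv ℝ n (d j) x‖ :=
      (hd 0 n).of_nonneg_of_le (fun _ => norm_nonneg _) fun j => hbd n j x le_top
    calc ‖x‖ ^ k * ‖∑' j, iteratedFDeriv ℝ n (d j) x‖
        ≤ ‖x‖ ^ k * ∑' j, ‖iteratedFDeriv ℝ n (d j) x‖ := by
          gcongr; exact norm_tsum_le_tsum_norm hs
      _ = ∑' j, ‖x‖ ^ k * ‖iteratedFDeriv ℝ n (d j) x‖ := tsum_mul_left.symm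
      _ ≤ _ := (hs.mul_left _).tsum_le_tsum (fun j => le_seminorm ℝ k n (d j) x) (hd k n)
  let F : 𝓢(V, W) :=
    ⟨fun y => ∑' j, d j y, contDiff_tsum hsm (fun k _ => hd 0 k) hbd,
      fun k n => ⟨_, hdecay k n⟩⟩
  refine ⟨F, fun x => ?_, fun k n => ?_⟩
  · exact (Summable.of_norm_bounded (hd 0 0) fun j => norm_le_seminorm ℝ (d j) x).hasSum
  · exact seminorm_le_bound ℝ k n F (tsum_nonneg fun j => apply_nonneg _ _) (hdecay k n)

open Filter Topology in
/-- If the consecutive differences of a sequence of Schwartz functions are absolutely summable for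
every Schwartz seminorm, the sequence converges. -/
theorem exists_tendsto_of_summable_seminorm_sub (u : ℕ → 𝓢(V, W))
    (hu : ∀ k n, Summable fun j => SchwartzMap.seminorm ℝ k n (u (j + 1) - u j)) :
    ∃ F, Tendsto u atTop (𝓝 F) := by
  obtain ⟨F, hF, -⟩ := exists_hasSum_of_summable_seminorm _ hu
  refine ⟨u 0 + F, ((schwartz_withSeminorms ℝ V W).tendsto_nhds_atTop _ _).2 ?_⟩
  rintro ⟨k, n⟩ ε hε
  have htail := tendsto_sum_nat_add fun j => SchwartzMap.seminorm ℝ k n (u (j + 1) - u j)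
  obtain ⟨N, hN⟩ := eventually_atTop.1 (htail.eventually_lt_const hε)
  refine ⟨N, fun M hM => ?_⟩
  obtain ⟨G, hG, hGle⟩ := exists_hasSum_of_summable_seminorm (fun j => u (j + M + 1) - u (j + M))
    fun k n => (summable_nat_add_iff M).2 (hu k n)
  have hsub : u M - (u 0 + F) = -G := by
    ext x
    have h1 := (hasSum_nat_add_iff' M).2 (hF x)
    have h2 : ∑ i ∈ Finset.range M, (u (i + 1) - u i) x = u M x - u 0 x := by
      simpa using Finset.sum_range_sub (fun i => u i x) M
    rw [h2] at h1
    have h3 := h1.unique (hG x)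
    simp only [sub_apply, add_apply, neg_apply, ← h3]
    abel
  rw [hsub, map_neg_eq_map]
  exact (hGle k n).trans_lt (hN M hM)

open Filter Topology Uniformity in
/-- The Schwartz space with values in a Banach space is complete. -/
instance instCompleteSpace : CompleteSpace 𝓢(V, W) := by
  have : (𝓤 𝓢(V, W)).IsCountablyGenerated := IsUniformAddGroup.uniformity_countably_generated
  refine UniformSpace.complete_of_convergent_controlled_sequences
    (fun N => {f | ∀ k ∈ Finset.range (N + 1), ∀ n ∈ Finset.range (N + 1),
      SchwartzMap.seminorm ℝ k n (f.2 - f.1) < (1 / 2) ^ N}) (fun N => ?_) fun u hu => ?_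
  · rw [uniformity_eq_comap_nhds_zero]
    refine ⟨{f | ∀ k ∈ Finset.range (N + 1), ∀ n ∈ Finset.range (N + 1),
      SchwartzMap.seminorm ℝ k n f < (1 / 2) ^ N}, ?_, fun f hf => hf⟩
    refine (Finset.eventually_all _).2 fun k _ => (Finset.eventually_all _).2 fun n _ => ?_
    have hc : Continuous (SchwartzMap.seminorm ℝ k n : 𝓢(V, W) → ℝ) :=
      (schwartz_withSeminorms ℝ V W).continuous_seminorm (k, n)
    exact (hc.tendsto 0).eventually_lt_const (by simp)
  · refine exists_tendsto_of_summable_seminorm_sub u fun k n => ?_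
    refine Summable.of_norm_bounded_eventually_nat (g := fun j : ℕ => (1 / 2 : ℝ) ^ j)
      summable_geometric_two ?_
    filter_upwards [eventually_ge_atTop (max k n)] with j hj
    rw [Real.norm_of_nonneg (apply_nonneg _ _)]
    exact (hu j j (j + 1) le_rfl (Nat.le_succ j) k
      (Finset.mem_range.2 (by omega)) n (Finset.mem_range.2 (by omega))).le

/-- At every point some Schwartz function takes the value one. -/
theorem exists_apply_eq_one [FiniteDimensional ℝ V] (x : V) : ∃ g : 𝓢(V, ℂ), g x = 1 := by
  let b : ContDiffBump x := default
  have hc : HasCompactSupport fun y => (b y : ℂ) :=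
    b.hasCompactSupport.comp_left (g := Complex.ofReal) Complex.ofReal_zero
  have hs : ContDiff ℝ (⊤ : ℕ∞) fun y => (b y : ℂ) := Complex.ofRealCLM.contDiff.comp b.contDiff
  have hx : (b x : ℂ) = 1 := by
    rw [b.one_of_mem_closedBall (Metric.mem_closedBall_self b.rIn_pos.le), Complex.ofReal_one]
  exact ⟨hc.toSchwartzMap hs, hx⟩

end SchwartzMap

/-- If `e` is an 𝒮-basis of `𝒮'_n` (transpose of `E` bijective), `f` is slowly increasing,
and the product family `fe` (associated operator `M_f ∘ E`) is also an 𝒮-basis of `𝒮'_n`,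
then `f` is nowhere vanishing and for every Schwartz `g` there is `h` with `f·E(h) = g`,
so that `g/f = E(h)` is again a Schwartz function. -/
theorem basis_mul_nonvanishing_div {n m : ℕ}
    (E : 𝓢((Fin n → ℝ), ℂ) →L[ℂ] 𝓢((Fin m → ℝ), ℂ))
    (hE : Function.Bijective
      (fun a : 𝓢((Fin m → ℝ), ℂ) →L[ℂ] ℂ => a.comp E))
    (f : (Fin m → ℝ) → ℂ) (hf : SlowlyIncreasing f)
    (M : 𝓢((Fin m → ℝ), ℂ) →L[ℂ] 𝓢((Fin m → ℝ), ℂ))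
    (hM : ∀ (g : 𝓢((Fin m → ℝ), ℂ)) (x : Fin m → ℝ), M g x = f x * g x)
    (hfE : Function.Bijective
      (fun a : 𝓢((Fin m → ℝ), ℂ) →L[ℂ] ℂ => a.comp (M.comp E))) :
    (∀ x, f x ≠ 0) ∧
      ∀ g : 𝓢((Fin m → ℝ), ℂ), ∃ h : 𝓢((Fin n → ℝ), ℂ),
        (∀ x, f x * E h x = g x) ∧ (∀ x, E h x = g x / f x) := by
  have hsurj : ∀ g, ∃ h, M (E h) = g :=
    (M.comp E).surjective_of_bijective_transpose (schwartz_withSeminorms ℂ (Fin n → ℝ) ℂ) hfE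
  have hf0 : ∀ x, f x ≠ 0 := by
    intro x hx
    obtain ⟨g, hg⟩ := SchwartzMap.exists_apply_eq_one x
    obtain ⟨h, rfl⟩ := hsurj g
    simp [hM, hx] at hg
  refine ⟨hf0, fun g => ?_⟩
  obtain ⟨h, rfl⟩ := hsurj g
  exact ⟨h, fun x => (hM _ x).symm, fun x => by rw [hM, mul_div_cancel_left₀ _ (hf0 x)]⟩
end
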